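/- arXiv:2305.05011 — 5 statements merged into one kernel-verified Lean document; each statement's English description precedes it below -/
import Mathlib

section
/- Let n ≥ 3 be an integer, ε > 0 a real number, and let G be an n×n real matrix with entries in {0,1} and zero diagonal (a simple directed graph). Then ⟨G,Q⟩ ≤ n(1+ε) for every Q ∈ Q_t ∪ Q_nt, and there exists Q ∈ Q_t ∪ Q_nt with ⟨G,Q⟩ = n(1+ε) if and only if G is Hamiltonian, i.e. there exists a permutation σ of Fin n that is an n-cycle (a cycle with support all of Fin n) such that G i (σ i) = 1 for every i. -/
open Matrix Finset

/-- The 0/1 permutation matrix of `σ`: entry `(i,j)` equals 1 iff `j = σ i`. -/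
def permMat (n : ℕ) (σ : Equiv.Perm (Fin n)) : Matrix (Fin n) (Fin n) ℝ :=
  fun i j => if j = σ i then 1 else 0

/-- `σ` is a tour permutation: an `n`-cycle, i.e. a cycle with support all of `Fin n`. -/
def IsTourPerm (n : ℕ) (σ : Equiv.Perm (Fin n)) : Prop :=
  σ.IsCycle ∧ σ.support = Finset.univ

/-- The set of tour permutation matrices. -/
def Pt (n : ℕ) : Set (Matrix (Fin n) (Fin n) ℝ) :=
  {M | ∃ σ : Equiv.Perm (Fin n), IsTourPerm n σ ∧ M = permMat n σ}

/-- The set of non-tour permutation matrices. -/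
def Pnt (n : ℕ) : Set (Matrix (Fin n) (Fin n) ℝ) :=
  {M | ∃ σ : Equiv.Perm (Fin n), ¬ IsTourPerm n σ ∧ M = permMat n σ}

/-- The all-ones matrix. -/
def Jmat (n : ℕ) : Matrix (Fin n) (Fin n) ℝ := fun _ _ => 1

/-- The set of stretched tours `Q_t = {(1+ε)·P : P ∈ P_t}`. -/
def Qt (n : ℕ) (ε : ℝ) : Set (Matrix (Fin n) (Fin n) ℝ) :=
  {M | ∃ P ∈ Pt n, M = (1 + ε) • P}

/-- The set of translated non-tours `Q_nt = {P + (ε/n)·J : P ∈ P_nt}`. -/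
def Qnt (n : ℕ) (ε : ℝ) : Set (Matrix (Fin n) (Fin n) ℝ) :=
  {M | ∃ P ∈ Pnt n, M = P + (ε / n) • Jmat n}

/-- The inner product `⟨G,Q⟩ = ∑_{i,j} G i j · Q i j`. -/
def ip (n : ℕ) (G Q : Matrix (Fin n) (Fin n) ℝ) : ℝ :=
  ∑ i, ∑ j, G i j * Q i j

/-- `G` is (the adjacency matrix of) a simple directed graph: 0/1 entries, zero diagonal. -/
def IsSimpleGraphMat (n : ℕ) (G : Matrix (Fin n) (Fin n) ℝ) : Prop :=
  (∀ i j, G i j = 0 ∨ G i j = 1) ∧ ∀ i, G i i = 0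

/-- `G` is Hamiltonian: some tour permutation has all its arcs in `G`. -/
def IsHamiltonian (n : ℕ) (G : Matrix (Fin n) (Fin n) ℝ) : Prop :=
  ∃ σ : Equiv.Perm (Fin n), IsTourPerm n σ ∧ ∀ i, G i (σ i) = 1

theorem ip_permMat (n : ℕ) (G : Matrix (Fin n) (Fin n) ℝ) (σ : Equiv.Perm (Fin n)) :
    ip n G (permMat n σ) = ∑ i, G i (σ i) := by
  simp [ip, permMat]

theorem ip_smul (n : ℕ) (c : ℝ) (G Q : Matrix (Fin n) (Fin n) ℝ) :
    ip n G (c • Q) = c * ip n G Q := by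
  simp only [ip, Matrix.smul_apply, smul_eq_mul, Finset.mul_sum]
  exact Finset.sum_congr rfl fun i _ => Finset.sum_congr rfl fun j _ => by ring

theorem ip_add (n : ℕ) (G P Q : Matrix (Fin n) (Fin n) ℝ) :
    ip n G (P + Q) = ip n G P + ip n G Q := by
  simp [ip, mul_add, Finset.sum_add_distrib]

theorem IsSimpleGraphMat.le_one {n : ℕ} {G : Matrix (Fin n) (Fin n) ℝ}
    (hG : IsSimpleGraphMat n G) (i j : Fin n) : G i j ≤ 1 := by
  rcases hG.1 i j with h | h <;> simp [h]

theorem IsSimpleGraphMat.ip_permMat_le {n : ℕ} {G : Matrix (Fin n) (Fin n) ℝ}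
    (hG : IsSimpleGraphMat n G) (σ : Equiv.Perm (Fin n)) : ip n G (permMat n σ) ≤ n := by
  rw [ip_permMat]
  simpa using Finset.sum_le_sum fun i (_ : i ∈ Finset.univ) => hG.le_one i (σ i)

theorem IsSimpleGraphMat.ip_permMat_eq_iff {n : ℕ} {G : Matrix (Fin n) (Fin n) ℝ}
    (hG : IsSimpleGraphMat n G) (σ : Equiv.Perm (Fin n)) :
    ip n G (permMat n σ) = n ↔ ∀ i, G i (σ i) = 1 := by
  rw [ip_permMat]
  simpa using Finset.sum_eq_sum_iff_of_le fun i (_ : i ∈ Finset.univ) => hG.le_one i (σ i)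

theorem IsSimpleGraphMat.ip_Jmat_lt {n : ℕ} {G : Matrix (Fin n) (Fin n) ℝ}
    (hG : IsSimpleGraphMat n G) (hn : 0 < n) : ip n G (Jmat n) < n * n := by
  have : NeZero n := ⟨hn.ne'⟩
  have h : ∑ i, ∑ j, G i j < ∑ _i : Fin n, ∑ _j : Fin n, (1 : ℝ) :=
    Finset.sum_lt_sum_of_nonempty Finset.univ_nonempty fun i _ =>
      Finset.sum_lt_sum (fun j _ => hG.le_one i j)
        ⟨i, Finset.mem_univ i, by simp [hG.2 i]⟩
  simpa [ip, Jmat] using h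

theorem IsSimpleGraphMat.ip_lt_of_mem_Qnt {n : ℕ} {G Q : Matrix (Fin n) (Fin n) ℝ} {ε : ℝ}
    (hG : IsSimpleGraphMat n G) (hn : 0 < n) (hε : 0 < ε) (hQ : Q ∈ Qnt n ε) :
    ip n G Q < n * (1 + ε) := by
  obtain ⟨_, ⟨σ, -, rfl⟩, rfl⟩ := hQ
  have hn' : (0 : ℝ) < n := Nat.cast_pos.mpr hn
  have h : ε / n * ip n G (Jmat n) < ε / n * (n * n) :=
    mul_lt_mul_of_pos_left (hG.ip_Jmat_lt hn) (div_pos hε hn')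
  have h' : ε / n * ((n : ℝ) * n) = n * ε := by field_simp
  rw [ip_add, ip_smul]
  linarith [hG.ip_permMat_le σ]

theorem stmt4 (n : ℕ) (hn : 3 ≤ n) (ε : ℝ) (hε : 0 < ε)
    (G : Matrix (Fin n) (Fin n) ℝ) (hG : IsSimpleGraphMat n G) :
    (∀ Q ∈ Qt n ε ∪ Qnt n ε, ip n G Q ≤ n * (1 + ε)) ∧
      ((∃ Q ∈ Qt n ε ∪ Qnt n ε, ip n G Q = n * (1 + ε)) ↔ IsHamiltonian n G) := by
  have hn' : 0 < n := by lia
  have hε' : 0 < 1 + ε := by linarith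
  refine ⟨?_, ?_, ?_⟩
  · rintro Q (⟨_, ⟨σ, -, rfl⟩, rfl⟩ | hQ)
    · rw [ip_smul, mul_comm]
      exact mul_le_mul_of_nonneg_right (hG.ip_permMat_le σ) hε'.le
    · exact (hG.ip_lt_of_mem_Qnt hn' hε hQ).le
  · rintro ⟨Q, ⟨_, ⟨σ, hσ, rfl⟩, rfl⟩ | hQ, h⟩
    · rw [ip_smul, mul_comm] at h
      exact ⟨σ, hσ, (hG.ip_permMat_eq_iff σ).1 (mul_right_cancel₀ hε'.ne' h)⟩
    · exact absurd h (hG.ip_lt_of_mem_Qnt hn' hε hQ).ne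
  · rintro ⟨σ, hσ, h⟩
    refine ⟨_, Or.inl ⟨_, ⟨σ, hσ, rfl⟩, rfl⟩, ?_⟩
    rw [ip_smul, (hG.ip_permMat_eq_iff σ).2 h, mul_comm]
end

section
/- Let n ≥ 4 be an integer and ε > 0 a real number. The affine span (in the real vector space of n×n real matrices) of the set Q_t ∪ Q_nt has dimension n² − 2n + 1. -/
open Matrix Finset

lemma not_isTourPerm_of_fixed {n : ℕ} {σ : Equiv.Perm (Fin n)} {x : Fin n} (hx : σ x = x) :
    ¬ IsTourPerm n σ := by
  rintro ⟨-, h⟩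
  have : x ∈ σ.support := h ▸ Finset.mem_univ x
  exact Equiv.Perm.mem_support.1 this hx

lemma IsTourPerm.pow_apply_ne {n : ℕ} {σ : Equiv.Perm (Fin n)} (h : IsTourPerm n σ) {k : ℕ}
    (hk : k ≠ 0) (hkn : k < n) (x : Fin n) : (σ ^ k) x ≠ x := by
  intro hx
  have hσ : σ x ≠ x := Equiv.Perm.mem_support.1 (h.2 ▸ Finset.mem_univ x)
  have h1 : σ ^ k = 1 := h.1.pow_eq_one_iff.2 ⟨x, hσ, hx⟩
  refine pow_ne_one_of_lt_orderOf hk ?_ h1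
  rw [h.1.orderOf, h.2]
  simpa using hkn

lemma sum_permMat_row {n : ℕ} (σ : Equiv.Perm (Fin n)) (i : Fin n) :
    ∑ j, permMat n σ i j = 1 := by
  simp [permMat]

lemma sum_permMat_col {n : ℕ} (σ : Equiv.Perm (Fin n)) (j : Fin n) :
    ∑ i, permMat n σ i j = 1 := by
  rw [← Equiv.sum_comp σ.symm]
  simp [permMat]

lemma permMat_apply_congr {n : ℕ} {σ τ : Equiv.Perm (Fin n)} {i : Fin n} (h : σ i = τ i)
    (j : Fin n) : permMat n σ i j = permMat n τ i j := by
  unfold permMat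
  rw [h]

lemma permMat_eq_of_disjoint_swaps {n : ℕ} (σ : Equiv.Perm (Fin n)) {a b c d : Fin n}
    (hac : a ≠ c) (had : a ≠ d) (hbc : b ≠ c) (hbd : b ≠ d) :
    permMat n σ = permMat n (σ * Equiv.swap a b) + permMat n (σ * Equiv.swap c d)
      - permMat n (σ * Equiv.swap a b * Equiv.swap c d) := by
  ext i j
  by_cases hi : i = a ∨ i = b
  · have h : Equiv.swap c d i = i := by
      apply Equiv.swap_apply_of_ne_of_ne <;> rcases hi with rfl | rfl <;> assumption
    have h1 : permMat n (σ * Equiv.swap c d) i j = permMat n σ i j :=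
      permMat_apply_congr (by simp [h]) j
    have h2 : permMat n (σ * Equiv.swap a b * Equiv.swap c d) i j
        = permMat n (σ * Equiv.swap a b) i j :=
      permMat_apply_congr (by simp [h]) j
    rw [Matrix.sub_apply, Matrix.add_apply, h1, h2, add_sub_cancel_left]
  · rw [not_or] at hi
    have h : Equiv.swap a b (Equiv.swap c d i) = Equiv.swap c d i := by
      apply Equiv.swap_apply_of_ne_of_ne <;> rw [Equiv.swap_apply_def] <;> split_ifs <;>
        first | exact hi.1 | exact hi.2 | exact Ne.symm ‹_›
    have h1 : permMat n (σ * Equiv.swap a b) i j = permMat n σ i j :=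
      permMat_apply_congr (by simp [Equiv.swap_apply_of_ne_of_ne hi.1 hi.2]) j
    have h2 : permMat n (σ * Equiv.swap a b * Equiv.swap c d) i j
        = permMat n (σ * Equiv.swap c d) i j :=
      permMat_apply_congr (by simp [h]) j
    rw [Matrix.sub_apply, Matrix.add_apply, h1, h2, add_sub_cancel_right]

lemma sum_row_of_mem_Qt_union_Qnt {n : ℕ} (hn : n ≠ 0) {ε : ℝ} {M : Matrix (Fin n) (Fin n) ℝ}
    (hM : M ∈ Qt n ε ∪ Qnt n ε) (i : Fin n) : ∑ j, M i j = 1 + ε := by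
  have hn' : (n : ℝ) ≠ 0 := Nat.cast_ne_zero.2 hn
  rcases hM with ⟨_, ⟨σ, -, rfl⟩, rfl⟩ | ⟨_, ⟨σ, -, rfl⟩, rfl⟩
  · simp [← Finset.mul_sum, sum_permMat_row]
  · simp [Finset.sum_add_distrib, sum_permMat_row, Jmat]
    field_simp

lemma sum_col_of_mem_Qt_union_Qnt {n : ℕ} (hn : n ≠ 0) {ε : ℝ} {M : Matrix (Fin n) (Fin n) ℝ}
    (hM : M ∈ Qt n ε ∪ Qnt n ε) (j : Fin n) : ∑ i, M i j = 1 + ε := by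
  have hn' : (n : ℝ) ≠ 0 := Nat.cast_ne_zero.2 hn
  rcases hM with ⟨_, ⟨σ, -, rfl⟩, rfl⟩ | ⟨_, ⟨σ, -, rfl⟩, rfl⟩
  · simp [← Finset.mul_sum, sum_permMat_col]
  · simp [Finset.sum_add_distrib, sum_permMat_col, Jmat]
    field_simp

/-- The matrices all of whose row and column sums vanish. -/
def zeroLineSums (n : ℕ) : Submodule ℝ (Matrix (Fin n) (Fin n) ℝ) where
  carrier := {M | (∀ i, ∑ j, M i j = 0) ∧ ∀ j, ∑ i, M i j = 0}
  zero_mem' := by simp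
  add_mem' hA hB := by
    constructor <;> intro k <;> simp [Finset.sum_add_distrib, hA.1, hA.2, hB.1, hB.2]
  smul_mem' c A hA := by
    constructor <;> intro k <;> simp [← Finset.mul_sum, hA.1, hA.2]

lemma vectorSpan_le_zeroLineSums {n : ℕ} (hn : n ≠ 0) (ε : ℝ) :
    vectorSpan ℝ (Qt n ε ∪ Qnt n ε) ≤ zeroLineSums n := by
  refine Submodule.span_le.2 ?_
  rintro _ ⟨A, hA, B, hB, rfl⟩
  constructor <;> intro k <;>
    simp [sum_row_of_mem_Qt_union_Qnt hn hA, sum_row_of_mem_Qt_union_Qnt hn hB,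
      sum_col_of_mem_Qt_union_Qnt hn hA, sum_col_of_mem_Qt_union_Qnt hn hB]

lemma permMat_sub_permMat_mem_of_not_isTourPerm {n : ℕ} (ε : ℝ) {σ τ : Equiv.Perm (Fin n)}
    (hσ : ¬ IsTourPerm n σ) (hτ : ¬ IsTourPerm n τ) :
    permMat n σ - permMat n τ ∈ vectorSpan ℝ (Qt n ε ∪ Qnt n ε) := by
  have key : ∀ ρ, ¬ IsTourPerm n ρ → permMat n ρ + (ε / n) • Jmat n ∈ Qt n ε ∪ Qnt n ε :=
    fun ρ hρ => Or.inr ⟨_, ⟨ρ, hρ, rfl⟩, rfl⟩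
  simpa using vsub_mem_vectorSpan ℝ (key σ hσ) (key τ hτ)

lemma permMat_sub_permMat_one_mem {n : ℕ} (hn : 4 ≤ n) (ε : ℝ) (σ : Equiv.Perm (Fin n)) :
    permMat n σ - permMat n 1 ∈ vectorSpan ℝ (Qt n ε ∪ Qnt n ε) := by
  have h1 : ¬ IsTourPerm n 1 := fun h => h.1.ne_one rfl
  by_cases hσ : IsTourPerm n σ
  swap
  · exact permMat_sub_permMat_mem_of_not_isTourPerm ε hσ h1
  let a : Fin n := ⟨0, by omega⟩
  have d1 (x : Fin n) : σ x ≠ x := hσ.pow_apply_ne one_ne_zero (by omega) x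
  have d2 (x : Fin n) : σ (σ x) ≠ x := hσ.pow_apply_ne two_ne_zero (by omega) x
  have d3 (x : Fin n) : σ (σ (σ x)) ≠ x := hσ.pow_apply_ne three_ne_zero (by omega) x
  have hrel := permMat_eq_of_disjoint_swaps σ (d2 a).symm (d3 a).symm (d1 (σ a)).symm
    (d2 (σ a)).symm
  have f1 : ¬ IsTourPerm n (σ * Equiv.swap a (σ a)) :=
    not_isTourPerm_of_fixed (x := σ a) (by simp)
  have f2 : ¬ IsTourPerm n (σ * Equiv.swap (σ (σ a)) (σ (σ (σ a)))) :=
    not_isTourPerm_of_fixed (x := σ (σ (σ a))) (by simp)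
  have f3 : ¬ IsTourPerm n (σ * Equiv.swap a (σ a) * Equiv.swap (σ (σ a)) (σ (σ (σ a)))) := by
    refine not_isTourPerm_of_fixed (x := σ a) ?_
    simp [Equiv.swap_apply_of_ne_of_ne (d1 (σ a)).symm (d2 (σ a)).symm]
  rw [hrel]
  convert Submodule.add_mem _ (permMat_sub_permMat_mem_of_not_isTourPerm ε f1 f3)
    (permMat_sub_permMat_mem_of_not_isTourPerm ε f2 h1) using 1
  abel

/-- Deletion of the last row and the last column. -/
def dropLast (m : ℕ) :
    Matrix (Fin (m + 1)) (Fin (m + 1)) ℝ →ₗ[ℝ] Matrix (Fin m) (Fin m) ℝ where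
  toFun M := M.submatrix Fin.castSucc Fin.castSucc
  map_add' _ _ := rfl
  map_smul' _ _ := rfl

lemma dropLast_apply {m : ℕ} (M : Matrix (Fin (m + 1)) (Fin (m + 1)) ℝ) (i j : Fin m) :
    dropLast m M i j = M i.castSucc j.castSucc := rfl

lemma eq_zero_of_dropLast_eq_zero {m : ℕ} {M : Matrix (Fin (m + 1)) (Fin (m + 1)) ℝ}
    (hM : M ∈ zeroLineSums (m + 1)) (h : dropLast m M = 0) : M = 0 := by
  have h0 (i j : Fin m) : M i.castSucc j.castSucc = 0 := congrFun (congrFun h i) j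
  have hcol (i : Fin m) : M i.castSucc (Fin.last m) = 0 := by
    simpa [Fin.sum_univ_castSucc, h0] using hM.1 i.castSucc
  have hlast (j : Fin (m + 1)) : M (Fin.last m) j = 0 := by
    have := hM.2 j
    induction j using Fin.lastCases with
    | last => simpa [Fin.sum_univ_castSucc, hcol] using this
    | cast j => simpa [Fin.sum_univ_castSucc, h0] using this
  ext i j
  induction i using Fin.lastCases with
  | last => exact hlast j
  | cast i =>
    induction j using Fin.lastCases with
    | last => exact hcol i
    | cast j => exact h0 i j

lemma dropLast_permMat_sub {m : ℕ} (i j : Fin m) :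
    dropLast m (permMat (m + 1) (Equiv.swap i.castSucc j.castSucc)
      - permMat (m + 1) (Equiv.swap i.castSucc j.castSucc
          * Equiv.swap i.castSucc (Fin.last m))) = Matrix.single i j 1 := by
  ext k l
  rw [dropLast_apply]
  by_cases hk : k = i
  · subst hk
    have hl : Equiv.swap k.castSucc j.castSucc (Fin.last m) = Fin.last m :=
      Equiv.swap_apply_of_ne_of_ne (Fin.castSucc_lt_last _).ne' (Fin.castSucc_lt_last _).ne'
    simp [permMat, hl, Matrix.single_apply, (Fin.castSucc_lt_last l).ne, eq_comm]
  · have h : Equiv.swap i.castSucc (Fin.last m) k.castSucc = k.castSucc :=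
      Equiv.swap_apply_of_ne_of_ne (by simpa using hk) (Fin.castSucc_lt_last _).ne
    simp [permMat, h, Ne.symm hk]

theorem stmt5 (n : ℕ) (hn : 4 ≤ n) (ε : ℝ) (hε : 0 < ε) :
    Module.finrank ℝ (affineSpan ℝ (Qt n ε ∪ Qnt n ε)).direction
      = n ^ 2 - 2 * n + 1 := by
  obtain ⟨m, rfl⟩ : ∃ m, n = m + 1 := ⟨n - 1, by omega⟩
  rw [direction_affineSpan]
  set D := vectorSpan ℝ (Qt (m + 1) ε ∪ Qnt (m + 1) ε)
  have hinj : Function.Injective ((dropLast m).domRestrict D) := by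
    rw [← LinearMap.ker_eq_bot, LinearMap.ker_eq_bot']
    intro M hM
    exact Subtype.ext
      (eq_zero_of_dropLast_eq_zero (vectorSpan_le_zeroLineSums m.succ_ne_zero ε M.2) hM)
  have hmem (σ τ : Equiv.Perm (Fin (m + 1))) :
      permMat (m + 1) σ - permMat (m + 1) τ ∈ D := by
    simpa using D.sub_mem (permMat_sub_permMat_one_mem hn ε σ) (permMat_sub_permMat_one_mem hn ε τ)
  have hsurj : Function.Surjective ((dropLast m).domRestrict D) := by
    rw [← LinearMap.range_eq_top, eq_top_iff]
    rintro A -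
    rw [Matrix.matrix_eq_sum_single A]
    refine Submodule.sum_mem _ fun i _ => Submodule.sum_mem _ fun j _ => ?_
    have h : Matrix.single i j (1 : ℝ) ∈ LinearMap.range ((dropLast m).domRestrict D) :=
      ⟨⟨_, hmem _ _⟩, dropLast_permMat_sub i j⟩
    simpa [Matrix.smul_single] using Submodule.smul_mem _ (A i j) h
  rw [(LinearEquiv.ofBijective _ ⟨hinj, hsurj⟩).finrank_eq, Module.finrank_matrix]
  have : (m + 1) ^ 2 = m * m + 2 * m + 1 := by ring
  simp only [Fintype.card_fin, Module.finrank_self, mul_one, this]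
  have : 0 < m * m := Nat.mul_pos (by omega) (by omega)
  omega
end

section
/- Let n ≥ 3 be an integer and ε > 0 a real number. Every matrix x in the convex hull of Q_t has trace x = 0, and every matrix y in the convex hull of Q_nt has trace y ≥ ε; consequently the affine hyperplane {x : trace x = ε/2} separates the convex hull of Q_t from the convex hull of Q_nt, and in particular the two convex hulls are disjoint. -/
open Matrix Finset

theorem trace_permMat (n : ℕ) (σ : Equiv.Perm (Fin n)) :
    (permMat n σ).trace = ∑ i, if i = σ i then (1 : ℝ) else 0 := rfl

theorem trace_Jmat (n : ℕ) : (Jmat n).trace = n := by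
  simp [Matrix.trace, Jmat]

theorem trace_permMat_nonneg (n : ℕ) (σ : Equiv.Perm (Fin n)) : 0 ≤ (permMat n σ).trace := by
  rw [trace_permMat]
  exact Finset.sum_nonneg fun i _ => by split_ifs <;> norm_num

theorem IsTourPerm.trace_permMat_eq_zero {n : ℕ} {σ : Equiv.Perm (Fin n)} (h : IsTourPerm n σ) :
    (permMat n σ).trace = 0 := by
  rw [trace_permMat]
  refine Finset.sum_eq_zero fun i _ => if_neg fun hi => ?_
  exact Equiv.Perm.mem_support.mp (h.2 ▸ Finset.mem_univ i) hi.symm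

theorem trace_eq_zero_of_mem_convexHull_Qt {n : ℕ} {ε : ℝ} {x : Matrix (Fin n) (Fin n) ℝ}
    (hx : x ∈ convexHull ℝ (Qt n ε)) : x.trace = 0 := by
  refine convexHull_min (t := {x | Matrix.traceLinearMap (Fin n) ℝ ℝ x = 0}) ?_
    (convex_hyperplane (LinearMap.isLinear _) 0) hx
  rintro _ ⟨_, ⟨σ, hσ, rfl⟩, rfl⟩
  simp [hσ.trace_permMat_eq_zero]

theorem le_trace_of_mem_convexHull_Qnt {n : ℕ} (hn : n ≠ 0) {ε : ℝ}
    {y : Matrix (Fin n) (Fin n) ℝ} (hy : y ∈ convexHull ℝ (Qnt n ε)) : ε ≤ y.trace := by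
  refine convexHull_min (t := {y | ε ≤ Matrix.traceLinearMap (Fin n) ℝ ℝ y}) ?_
    (convex_halfSpace_ge (LinearMap.isLinear _) ε) hy
  rintro _ ⟨_, ⟨σ, -, rfl⟩, rfl⟩
  have hn' : (n : ℝ) ≠ 0 := Nat.cast_ne_zero.mpr hn
  simpa [trace_Jmat, hn'] using trace_permMat_nonneg n σ

theorem stmt10 (n : ℕ) (hn : 3 ≤ n) (ε : ℝ) (hε : 0 < ε) :
    (∀ x ∈ convexHull ℝ (Qt n ε), Matrix.trace x = 0) ∧
    (∀ y ∈ convexHull ℝ (Qnt n ε), ε ≤ Matrix.trace y) ∧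
    (∀ x ∈ convexHull ℝ (Qt n ε), Matrix.trace x < ε / 2) ∧
    (∀ y ∈ convexHull ℝ (Qnt n ε), ε / 2 < Matrix.trace y) ∧
    Disjoint (convexHull ℝ (Qt n ε)) (convexHull ℝ (Qnt n ε)) := by
  have ht : ∀ x ∈ convexHull ℝ (Qt n ε), Matrix.trace x = 0 := fun _ hx =>
    trace_eq_zero_of_mem_convexHull_Qt hx
  have hnt : ∀ y ∈ convexHull ℝ (Qnt n ε), ε ≤ Matrix.trace y := fun _ hy =>
    le_trace_of_mem_convexHull_Qnt (by omega) hy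
  refine ⟨ht, hnt, fun x hx => ?_, fun y hy => ?_, Set.disjoint_left.mpr fun x hx hy => ?_⟩
  · linarith [ht x hx]
  · linarith [hnt y hy]
  · linarith [ht x hx, hnt x hy]
end

section
/- Let n ≥ 2 be an integer and ε > 0 a real number. Every Q ∈ Q_t is an extreme point of Ted's polytope T_n(ε), the convex hull of Q_t ∪ Q_nt; in particular T_n(ε) has at least as many extreme points as there are tours. -/
open Matrix Finset

/-- A point of `s` at which a linear functional has its strict maximum over `s` is an extreme point
of the convex hull of `s`. -/
theorem mem_extremePoints_convexHull_of_lt {E : Type*} [AddCommGroup E] [Module ℝ E]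
    {s : Set E} {x : E} (f : E →ₗ[ℝ] ℝ) (hx : x ∈ s) (hf : ∀ y ∈ s, y ≠ x → f y < f x) :
    x ∈ Set.extremePoints ℝ (convexHull ℝ s) := by
  have key : ∀ y z : E, (y = x ∨ f y < f x) → (z = x ∨ f z < f x) → ∀ a b : ℝ, 0 < a → 0 < b →
      a + b = 1 → (y = x ∧ z = x) ∨ f (a • y + b • z) < f x := by
    intro y z hy hz a b ha hb hab
    obtain rfl : b = 1 - a := by linarith
    simp only [map_add, map_smul, smul_eq_mul]
    rcases hy with rfl | hy <;> rcases hz with rfl | hz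
    · exact Or.inl ⟨rfl, rfl⟩
    all_goals right; nlinarith
  have hconv : Convex ℝ {y : E | y = x ∨ f y < f x} := by
    rw [convex_iff_forall_pos]
    intro y hy z hz a b ha hb hab
    rcases key y z hy hz a b ha hb hab with ⟨rfl, rfl⟩ | h
    · exact Or.inl (by rw [← add_smul, hab, one_smul])
    · exact Or.inr h
  have hsub : convexHull ℝ s ⊆ {y : E | y = x ∨ f y < f x} :=
    convexHull_min (fun y hy => or_iff_not_imp_left.2 (hf y hy)) hconv
  refine ⟨subset_convexHull ℝ s hx, ?_⟩
  rintro y hy z hz ⟨a, b, ha, hb, hab, h⟩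
  rcases key y z (hsub hy) (hsub hz) a b ha hb hab with ⟨rfl, rfl⟩ | h'
  · rfl
  · rw [h] at h'
    exact absurd h' (lt_irrefl _)

/-- The linear functional summing the entries of a matrix at the positions `(i, σ i)`. -/
def permSum (n : ℕ) (σ : Equiv.Perm (Fin n)) : Matrix (Fin n) (Fin n) ℝ →ₗ[ℝ] ℝ where
  toFun M := ∑ i, M i (σ i)
  map_add' M N := by simp [Finset.sum_add_distrib]
  map_smul' c M := by simp [Finset.mul_sum]

theorem permSum_self (n : ℕ) (σ : Equiv.Perm (Fin n)) : permSum n σ (permMat n σ) = n := by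
  simp [permSum, permMat]

theorem permSum_permMat_lt (n : ℕ) {σ τ : Equiv.Perm (Fin n)} (h : τ ≠ σ) :
    permSum n σ (permMat n τ) < n := by
  obtain ⟨i, hi⟩ : ∃ i, τ i ≠ σ i := by
    by_contra! hc
    exact h (Equiv.ext hc)
  calc permSum n σ (permMat n τ) < ∑ _i : Fin n, (1 : ℝ) := by
        refine Finset.sum_lt_sum (fun j _ => ?_) ⟨i, Finset.mem_univ i, ?_⟩
        · unfold permMat
          split_ifs <;> norm_num
        · simp [permMat, hi.symm]
    _ = n := by simp

theorem permSum_Jmat (n : ℕ) (σ : Equiv.Perm (Fin n)) : permSum n σ (Jmat n) = n := by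
  simp [permSum, Jmat]

theorem finite_setOf_permMat (n : ℕ) (p : Equiv.Perm (Fin n) → Prop) :
    {M | ∃ σ, p σ ∧ M = permMat n σ}.Finite :=
  (Set.finite_range (permMat n)).subset (by rintro _ ⟨σ, -, rfl⟩; exact ⟨σ, rfl⟩)

theorem Qt_eq_image (n : ℕ) (ε : ℝ) : Qt n ε = (fun M => (1 + ε) • M) '' Pt n := by
  ext M
  simp [Qt, eq_comm]

theorem Qnt_eq_image (n : ℕ) (ε : ℝ) : Qnt n ε = (fun M => M + (ε / n) • Jmat n) '' Pnt n := by
  ext M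
  simp only [Qnt, Set.mem_ofPred_eq, Set.mem_image, eq_comm]

theorem stmt11 (n : ℕ) (hn : 2 ≤ n) (ε : ℝ) (hε : 0 < ε) :
    (∀ Q ∈ Qt n ε,
        Q ∈ Set.extremePoints ℝ (convexHull ℝ (Qt n ε ∪ Qnt n ε))) ∧
      (Pt n).ncard ≤
        (Set.extremePoints ℝ (convexHull ℝ (Qt n ε ∪ Qnt n ε))).ncard := by
  have hn' : (2 : ℝ) ≤ n := by exact_mod_cast hn
  have hext : ∀ Q ∈ Qt n ε,
      Q ∈ Set.extremePoints ℝ (convexHull ℝ (Qt n ε ∪ Qnt n ε)) := by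
    rintro _ ⟨_, ⟨σ, hσ, rfl⟩, rfl⟩
    refine mem_extremePoints_convexHull_of_lt (permSum n σ)
      (Or.inl ⟨_, ⟨σ, hσ, rfl⟩, rfl⟩) ?_
    rintro _ (⟨_, ⟨τ, hτ, rfl⟩, rfl⟩ | ⟨_, ⟨τ, hτ, rfl⟩, rfl⟩) hne
    · have h : τ ≠ σ := by
        rintro rfl
        exact hne rfl
      simp only [map_smul, smul_eq_mul, permSum_self]
      exact mul_lt_mul_of_pos_left (permSum_permMat_lt n h) (by linarith)
    · have h : τ ≠ σ := by
        rintro rfl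
        exact hτ hσ
      have hlt := permSum_permMat_lt n h
      simp only [map_add, map_smul, smul_eq_mul, permSum_self, permSum_Jmat]
      rw [div_mul_cancel₀ _ (by positivity)]
      nlinarith
  refine ⟨hext, ?_⟩
  have hfin : (Qt n ε ∪ Qnt n ε).Finite := by
    rw [Qt_eq_image, Qnt_eq_image]
    exact ((finite_setOf_permMat n _).image _).union ((finite_setOf_permMat n _).image _)
  have hinj : Function.Injective fun M : Matrix (Fin n) (Fin n) ℝ => (1 + ε) • M :=
    smul_right_injective _ (by positivity)
  rw [← Set.ncard_image_of_injective (Pt n) hinj, ← Qt_eq_image]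
  exact Set.ncard_le_ncard hext (hfin.subset extremePoints_convexHull_subset)
end

section
/- Let n ≥ 2 be an integer and ε > 0 a real number. For every Q_t-point Q and every Q_nt-point Q', the Frobenius norms satisfy ∑_{i,j} (Q' i j)² = n + ε(2+ε) < n(1+ε)² = ∑_{i,j} (Q i j)²; that is, every translated non-tour lies strictly inside the sphere of radius (1+ε)√n on which all stretched tours lie. -/
open Matrix Finset

theorem sum_sq_smul_permMat (n : ℕ) (σ : Equiv.Perm (Fin n)) (a : ℝ) :
    ∑ i, ∑ j, ((a • permMat n σ) i j) ^ 2 = n * a ^ 2 := by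
  simp [permMat, ite_pow]

theorem sum_sq_permMat_add_smul_Jmat (n : ℕ) (σ : Equiv.Perm (Fin n)) (c : ℝ) :
    ∑ i, ∑ j, ((permMat n σ + c • Jmat n) i j) ^ 2 = n * (1 + 2 * c + n * c ^ 2) := by
  have h (i j : Fin n) : ((permMat n σ + c • Jmat n) i j) ^ 2 =
      (if j = σ i then 1 + 2 * c else 0) + c ^ 2 := by
    simp only [permMat, Jmat, Matrix.add_apply, Matrix.smul_apply, smul_eq_mul]
    split_ifs <;> ring
  simp only [h]
  simp [Finset.sum_add_distrib, mul_add]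

theorem stmt14 (n : ℕ) (hn : 2 ≤ n) (ε : ℝ) (hε : 0 < ε) :
    ∀ Q ∈ Qt n ε, ∀ Q' ∈ Qnt n ε,
      (∑ i, ∑ j, (Q' i j) ^ 2 = n + ε * (2 + ε)) ∧
        (n : ℝ) + ε * (2 + ε) < n * (1 + ε) ^ 2 ∧
        (n : ℝ) * (1 + ε) ^ 2 = ∑ i, ∑ j, (Q i j) ^ 2 := by
  rintro _ ⟨_, ⟨σ, -, rfl⟩, rfl⟩ _ ⟨_, ⟨τ, -, rfl⟩, rfl⟩
  have hn' : (2 : ℝ) ≤ n := by exact_mod_cast hn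
  refine ⟨?_, ?_, (sum_sq_smul_permMat n σ (1 + ε)).symm⟩
  · rw [sum_sq_permMat_add_smul_Jmat]
    field_simp
    ring
  · have h : 0 < ε * (2 + ε) := by positivity
    nlinarith
end
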